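/- For every even integer k ≥ 10: (i) for every set S of vertices of G_k with |S| ≤ 4, the subgraph of G_k induced on the complement of S is connected; and (ii) there exists a set S of exactly 5 vertices of G_k (namely S = {b_1, b_3, b_5, b_7, b_9}, the neighborhood of the added vertex w) such that the subgraph of G_k induced on the complement of S is disconnected. Hence the connectivity of G_k is exactly 5. -/

import Mathlib

open SimpleGraph

/-- Vertex type of the graph `H_k`: four disjoint families
`b_i` (`i` mod `k`), `u_j` (`j` mod `3k`), `v_j` (`j` mod `3k`), `a_i` (`i` mod `k`). -/
inductive HkV (k : ℕ) : Type where
  | b : ZMod k → HkV k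
  | u : ZMod (3 * k) → HkV k
  | v : ZMod (3 * k) → HkV k
  | a : ZMod k → HkV k
deriving DecidableEq

/-- The natural map sending the residue `i` mod `k` to the residue `3 i` mod `3 k`. -/
def HkV.tr (k : ℕ) (i : ZMod k) : ZMod (3 * k) := 3 * (i.val : ZMod (3 * k))

/-- The base edge relation of `H_k`: the four cycles
`b_1 ⋯ b_k`, `u_1 ⋯ u_{3k}`, `v_1 ⋯ v_{3k}`, `a_1 ⋯ a_k`, together with the edges
`b_i u_{3i-2}`, `b_i u_{3i}`, `b_i u_{3i+2}`, the edges `u_j v_{j-1}`, `u_j v_{j+1}`,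
and the edges `a_i v_{3i-2}`, `a_i v_{3i}`, `a_i v_{3i+2}` (indices modulo `k`
resp. `3k`). -/
def hkRel (k : ℕ) : HkV k → HkV k → Prop
  | .b i, .b i' => i' = i + 1
  | .u j, .u j' => j' = j + 1
  | .v j, .v j' => j' = j + 1
  | .a i, .a i' => i' = i + 1
  | .b i, .u j => j = HkV.tr k i - 2 ∨ j = HkV.tr k i ∨ j = HkV.tr k i + 2
  | .u j, .v j' => j' = j - 1 ∨ j' = j + 1
  | .a i, .v j => j = HkV.tr k i - 2 ∨ j = HkV.tr k i ∨ j = HkV.tr k i + 2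
  | _, _ => False

/-- The graph `H_k` from the paper. -/
def Hk (k : ℕ) : SimpleGraph (HkV k) := SimpleGraph.fromRel (hkRel k)
/-- The base edge relation of `G_k`: the relation of `H_k` on the old vertices, together
with edges joining the new vertex (`none`) to `b_1, b_3, b_5, b_7, b_9`. -/
def gkRel (k : ℕ) : Option (HkV k) → Option (HkV k) → Prop
  | some x, some y => hkRel k x y
  | none, some (.b i) => i = 1 ∨ i = 3 ∨ i = 5 ∨ i = 7 ∨ i = 9
  | _, _ => False

/-- The graph `G_k` from the paper: `H_k` together with one new vertex `w = none` whose
neighborhood is exactly `{b_1, b_3, b_5, b_7, b_9}`. -/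
def Gk (k : ℕ) : SimpleGraph (Option (HkV k)) := SimpleGraph.fromRel (gkRel k)

/-- A finite set with fewer elements than a list of pairwise disjoint lists misses one of them. -/
theorem List.exists_forall_notMem_of_ncard_lt {α : Type*} {S : Set α} (hS : S.Finite)
    {L : List (List α)} (hL : L.flatten.Nodup) (h : S.ncard < L.length) :
    ∃ p ∈ L, ∀ y ∈ p, y ∉ S := by
  by_contra! hcon
  choose f hf hfS using fun i : Fin L.length => hcon L[i] (List.getElem_mem i.2)
  have hdisj := List.pairwise_iff_getElem.1 (List.nodup_flatten.1 hL).2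
  have hinj : Function.Injective f := by
    intro i j hij
    by_contra hne
    rcases lt_or_gt_of_ne hne with hlt | hlt
    · exact hdisj i j i.2 j.2 hlt (hf i) (hij ▸ hf j)
    · exact hdisj j i j.2 i.2 hlt (hf j) (hij ▸ hf i)
  have hcard : (Set.range f).ncard = L.length := by
    rw [← Nat.card_coe_set_eq, Nat.card_range_of_injective hinj, Nat.card_fin]
  have := Set.ncard_le_ncard (Set.range_subset_iff.2 hfS) hS
  omega

section Linked

variable {V : Type*} {G : SimpleGraph V} {S : Set V} {x y : V}

/-- `x` and `y` are joined by a walk of `G` all of whose edges avoid `S`. -/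
def SimpleGraph.Linked (G : SimpleGraph V) (S : Set V) : V → V → Prop :=
  Relation.ReflTransGen fun x y => G.Adj x y ∧ x ∉ S ∧ y ∉ S

theorem SimpleGraph.Linked.trans {z : V} (h : G.Linked S x y) (h' : G.Linked S y z) :
    G.Linked S x z :=
  Relation.ReflTransGen.trans h h'

theorem SimpleGraph.Linked.symm (h : G.Linked S x y) : G.Linked S y x :=
  haveI : Std.Symm fun x y => G.Adj x y ∧ x ∉ S ∧ y ∉ S :=
    ⟨fun _ _ h => ⟨h.1.symm, h.2.2, h.2.1⟩⟩
  Relation.ReflTransGen.stdSymm.symm _ _ h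

theorem SimpleGraph.Adj.linked (h : G.Adj x y) (hx : x ∉ S) (hy : y ∉ S) : G.Linked S x y :=
  Relation.ReflTransGen.single ⟨h, hx, hy⟩

theorem SimpleGraph.Linked.reachable (h : G.Linked S x y) (hx : x ∈ Sᶜ) (hy : y ∈ Sᶜ) :
    (G.induce Sᶜ).Reachable ⟨x, hx⟩ ⟨y, hy⟩ := by
  induction h with
  | refl => exact .refl _
  | tail _ hbc ih => exact (ih hbc.2.1).trans (SimpleGraph.Adj.reachable (by simpa using hbc.1))

theorem SimpleGraph.Linked.map {W : Type*} {G' : SimpleGraph W} (f : V → W)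
    (hf : ∀ x y, G.Adj x y → G'.Adj (f x) (f y)) {T : Set W} (h : G.Linked (f ⁻¹' T) x y) :
    G'.Linked T (f x) (f y) :=
  Relation.ReflTransGen.lift (p := fun x y => G'.Adj x y ∧ x ∉ T ∧ y ∉ T) f
    (fun _ _ h => ⟨hf _ _ h.1, h.2⟩) _ _ h

/-- A closed cyclic sequence of vertices with at most one index removed stays linked. -/
theorem SimpleGraph.linked_of_cyclic {N : ℕ} [NeZero N] {f : ZMod N → V} {p : ZMod N}
    (hf : ∀ z, f z ∉ S → f (z + 1) ∉ S → G.Linked S (f z) (f (z + 1)))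
    (hp : ∀ z ≠ p, f z ∉ S) {z w : ZMod N} (hz : f z ∉ S) (hw : f w ∉ S) :
    G.Linked S (f z) (f w) := by
  have key : ∀ t : ℕ, f (p + 1 + t) ∉ S → G.Linked S (f (p + 1)) (f (p + 1 + t)) := by
    intro t
    induction t with
    | zero => intro _; rw [Nat.cast_zero, add_zero]; exact Relation.ReflTransGen.refl
    | succ t ih =>
      intro ht
      have hcast : p + 1 + ((t + 1 : ℕ) : ZMod N) = p + 1 + t + 1 := by push_cast; ring
      rw [hcast] at ht ⊢
      by_cases halive : f (p + 1 + t) ∈ S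
      · have : p + 1 + (t : ZMod N) = p := by
          by_contra hne
          exact hp _ hne halive
        rw [this]
        exact Relation.ReflTransGen.refl
      · exact (ih halive).trans (hf _ halive ht)
  have key' : ∀ z, f z ∉ S → G.Linked S (f (p + 1)) (f z) := by
    intro z hz
    have : p + 1 + ((z - (p + 1)).val : ZMod N) = z := by
      rw [ZMod.natCast_zmod_val]; ring
    simpa only [this] using key (z - (p + 1)).val (by rwa [this])
  exact (key' z hz).symm.trans (key' w hw)

end Linked

/-- The vertices of the infinite strip that covers every `H_k`. -/
inductive StripV : Type where
  | b : ℤ → StripV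
  | u : ℤ → StripV
  | v : ℤ → StripV
  | a : ℤ → StripV
deriving DecidableEq

namespace StripV

/-- The lift of `hkRel` to the infinite strip. -/
def rel : StripV → StripV → Bool
  | b i, b i' => i' = i + 1
  | u j, u j' => j' = j + 1
  | v j, v j' => j' = j + 1
  | a i, a i' => i' = i + 1
  | b i, u j => j = 3 * i - 2 ∨ j = 3 * i ∨ j = 3 * i + 2
  | u j, v j' => j' = j - 1 ∨ j' = j + 1
  | a i, v j => j = 3 * i - 2 ∨ j = 3 * i ∨ j = 3 * i + 2
  | _, _ => false

/-- The covering map from the strip to `H_k`, taking column `0` to column `i`. -/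
def proj (k : ℕ) (i : ℤ) : StripV → HkV k
  | b n => .b ((i + n : ℤ) : ZMod k)
  | u n => .u ((3 * i + n : ℤ) : ZMod (3 * k))
  | v n => .v ((3 * i + n : ℤ) : ZMod (3 * k))
  | a n => .a ((i + n : ℤ) : ZMod k)

/-- The reflection of the strip in column `0`. -/
def reflect : StripV → StripV
  | b n => b (-n)
  | u n => u (-n)
  | v n => v (-n)
  | a n => a (-n)

/-- A window of the strip on which the covering maps are injective once `10 ≤ k`. -/
def inWindow : StripV → Bool
  | b n => -4 ≤ n ∧ n ≤ 4
  | u n => -14 ≤ n ∧ n ≤ 14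
  | v n => -14 ≤ n ∧ n ≤ 14
  | a n => -4 ≤ n ∧ n ≤ 4

/-- Membership in the path of the vertices of type `b`. -/
def isB : StripV → Bool
  | b _ => true
  | _ => false

/-- Membership in the path of the vertices of type `u`. -/
def isU : StripV → Bool
  | u _ => true
  | _ => false

/-- `L` consists of five paths from `x` to vertices satisfying `P` that are disjoint except in `x`
and stay in the window. -/
def IsFan (P : StripV → Bool) (x : StripV) (L : List (List StripV)) : Prop :=
  L.length = 5 ∧ L.flatten.Nodup ∧ (∀ y ∈ L.flatten, y.inWindow) ∧
    ∀ p ∈ L, (x :: p).IsChain (fun y z => rel y z || rel z y) ∧ ∃ y ∈ p, P y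

instance (P : StripV → Bool) (x : StripV) (L : List (List StripV)) : Decidable (IsFan P x L) := by
  unfold IsFan
  infer_instance

end StripV

theorem HkV.tr_intCast {k : ℕ} [NeZero k] (n : ℤ) :
    HkV.tr k (n : ZMod k) = ((3 * n : ℤ) : ZMod (3 * k)) := by
  have h : ((3 * ((n : ZMod k).val : ℤ) : ℤ) : ZMod (3 * k)) = ((3 * n : ℤ) : ZMod (3 * k)) := by
    rw [ZMod.intCast_eq_intCast_iff_dvd_sub, ZMod.val_intCast, ← mul_sub]
    push_cast
    exact mul_dvd_mul_left 3 (Int.dvd_self_sub_emod)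
  rw [← h, HkV.tr]
  push_cast
  rfl

namespace StripV

theorem hkRel_proj {k : ℕ} [NeZero k] (i : ℤ) {x y : StripV} (h : rel x y) :
    hkRel k (proj k i x) (proj k i y) := by
  cases x <;> cases y <;> simp only [rel, decide_eq_true_eq, Bool.false_eq_true] at h <;>
    simp only [hkRel, proj, HkV.tr_intCast]
  case b.u | a.v =>
    rcases h with h | h | h <;> subst h
    · left; push_cast; ring
    · right; left; push_cast; ring
    · right; right; push_cast; ring
  case u.v =>
    rcases h with h | h <;> subst h
    · left; push_cast; ring
    · right; push_cast; ring
  all_goals subst h; push_cast; ring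

theorem eq_of_intCast_eq {N : ℕ} {c m n : ℤ}
    (h : ((c + m : ℤ) : ZMod N) = ((c + n : ℤ) : ZMod N)) (hlt : |n - m| < N) : m = n := by
  rw [ZMod.intCast_eq_intCast_iff_dvd_sub, add_sub_add_left_eq_sub] at h
  have := Int.eq_zero_of_abs_lt_dvd h hlt
  omega

theorem proj_injOn {k : ℕ} (hk : 10 ≤ k) (i : ℤ) {x y : StripV} (hx : x.inWindow)
    (hy : y.inWindow) (h : proj k i x = proj k i y) : x = y := by
  cases x <;> cases y <;> simp only [proj, reduceCtorEq, HkV.b.injEq, HkV.u.injEq, HkV.v.injEq,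
    HkV.a.injEq] at h <;> simp only [inWindow, decide_eq_true_eq] at hx hy <;> congr 1 <;>
    refine eq_of_intCast_eq h (abs_lt.2 ?_) <;> push_cast <;> constructor <;> omega

end StripV

namespace Hk

variable {k : ℕ} {S : Set (HkV k)}

theorem linked_of_rel {x y : HkV k} (h : hkRel k x y) (hx : x ∉ S) (hy : y ∉ S) :
    (Hk k).Linked S x y := by
  by_cases hxy : x = y
  · subst hxy
    exact Relation.ReflTransGen.refl
  · exact SimpleGraph.Adj.linked ((SimpleGraph.fromRel_adj _ _ _).2 ⟨hxy, Or.inl h⟩) hx hy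

theorem linked_of_isChain [NeZero k] (i : ℤ) {x : StripV} {p : List StripV}
    (hp : (x :: p).IsChain fun y z => StripV.rel y z || StripV.rel z y)
    (hS : ∀ y ∈ x :: p, y.proj k i ∉ S) {y : StripV} (hy : y ∈ p) :
    (Hk k).Linked S (x.proj k i) (y.proj k i) := by
  induction p generalizing x with
  | nil => simp at hy
  | cons z p ih =>
    rw [List.isChain_cons_cons] at hp
    have hx := hS x (by simp)
    have hz := hS z (by simp)
    have hxz : (Hk k).Linked S (x.proj k i) (z.proj k i) := by
      rcases Bool.or_eq_true_iff.1 hp.1 with h | h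
      · exact linked_of_rel (StripV.hkRel_proj i h) hx hz
      · exact (linked_of_rel (StripV.hkRel_proj i h) hz hx).symm
    rcases List.mem_cons.1 hy with rfl | hy
    · exact hxz
    · exact hxz.trans (ih hp.2 (fun w hw => hS w (List.mem_cons_of_mem _ hw)) hy)

theorem exists_linked_of_isFan (hk : 10 ≤ k) (hfin : S.Finite) (hS : S.ncard ≤ 4)
    {P : StripV → Bool} {x : StripV} {L : List (List StripV)} (hL : StripV.IsFan P x L) (i : ℤ)
    (hx : x.proj k i ∉ S) :
    ∃ y : StripV, P y ∧ y.proj k i ∉ S ∧ (Hk k).Linked S (x.proj k i) (y.proj k i) := by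
  have : NeZero k := ⟨by omega⟩
  obtain ⟨hlen, hnodup, hwin, hpath⟩ := hL
  obtain ⟨q, hq, hqS⟩ := List.exists_forall_notMem_of_ncard_lt hfin
    (L := L.map (List.map (StripV.proj k i)))
    (by
      rw [← List.map_flatten]
      exact hnodup.map_on fun x hx y hy h => StripV.proj_injOn hk i (hwin x hx) (hwin y hy) h)
    (by rw [List.length_map]; omega)
  obtain ⟨p, hp, rfl⟩ := List.mem_map.1 hq
  obtain ⟨hchain, y, hy, hPy⟩ := hpath p hp
  have hpS : ∀ z ∈ p, z.proj k i ∉ S := fun z hz => hqS _ (List.mem_map_of_mem hz)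
  exact ⟨y, hPy, hpS y hy, linked_of_isChain i hchain (List.forall_mem_cons.2 ⟨hx, hpS⟩) hy⟩

section Fans

open StripV

theorem isFan_b_u_zero : IsFan isB (u 0)
    [[b 0], [u 1, b 1], [u (-1), b (-1)], [v 1, v 2, v 3, u 4, b 2],
      [v (-1), v (-2), v (-3), u (-4), b (-2)]] := by
  decide

theorem exists_isFan_b_u_one : ∃ L, IsFan isB (u 1) L ∧ IsFan isB (u (-1)) (L.map (.map reflect)) :=
  ⟨[[b 1], [u 2, b 0], [u 0, u (-1), b (-1)], [v 2, v 3, u 4, b 2],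
    [v 0, v (-1), v (-2), v (-3), u (-4), b (-2)]], by decide⟩

theorem isFan_b_v_zero : IsFan isB (v 0)
    [[u 1, b 1], [u (-1), b (-1)], [v 1, u 2, b 0], [v (-1), v (-2), v (-3), u (-4), b (-2)],
      [a 0, a 1, v 3, u 4, b 2]] := by
  decide

theorem exists_isFan_b_v_one : ∃ L, IsFan isB (v 1) L ∧ IsFan isB (v (-1)) (L.map (.map reflect)) :=
  ⟨[[u 0, b 0], [u 2, u 3, b 1], [v 0, u (-1), b (-1)], [v 2, v 3, u 4, b 2],
    [a 1, a 2, v 6, u 7, b 3]], by decide⟩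

theorem isFan_b_a : IsFan isB (a 0)
    [[v 2, u 1, b 1], [v (-2), u (-1), b (-1)], [v 0, v 1, u 0, b 0], [a 1, v 3, u 4, b 2],
      [a (-1), v (-3), u (-4), b (-2)]] := by
  decide

theorem isFan_u_b : IsFan isU (b 0)
    [[u (-2)], [u 0], [u 2], [b 1, u 1], [b (-1), u (-1)]] := by
  decide

theorem isFan_u_v_zero : IsFan isU (v 0)
    [[u (-1)], [u 1], [v 1, u 2], [v (-1), u (-2)], [a 0, v 2, u 3]] := by
  decide

theorem exists_isFan_u_v_one : ∃ L, IsFan isU (v 1) L ∧ IsFan isU (v (-1)) (L.map (.map reflect)) :=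
  ⟨[[u 0], [u 2], [v 2, u 3], [v 0, u (-1)], [a 1, v 3, u 4]], by decide⟩

theorem isFan_u_a : IsFan isU (a 0)
    [[v (-2), u (-3)], [v 0, u (-1)], [v 2, u 3], [a 1, v 1, u 2], [a (-1), v (-1), u (-2)]] := by
  decide

end Fans

/-- Every vertex of `H_k` lies in column `0` after a rotation. -/
theorem exists_proj_eq (x : HkV k) : ∃ (i : ℤ) (y : StripV), y.proj k i = x ∧
    y ∈ [.b 0, .u 0, .u 1, .u (-1), .v 0, .v 1, .v (-1), .a (0 : ℤ)] := by
  have hmod (m : ℤ) : ∃ i t : ℤ, 3 * i + t = m ∧ (t = 0 ∨ t = 1 ∨ t = -1) := by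
    refine ⟨(m + 1) / 3, m - 3 * ((m + 1) / 3), by ring, by omega⟩
  cases x with
  | b z =>
    obtain ⟨i, rfl⟩ := ZMod.intCast_surjective z
    exact ⟨i, .b 0, by simp [StripV.proj], by simp⟩
  | a z =>
    obtain ⟨i, rfl⟩ := ZMod.intCast_surjective z
    exact ⟨i, .a 0, by simp [StripV.proj], by simp⟩
  | u z =>
    obtain ⟨m, rfl⟩ := ZMod.intCast_surjective z
    obtain ⟨i, t, rfl, ht⟩ := hmod m
    exact ⟨i, .u t, rfl, by simpa using ht⟩
  | v z =>
    obtain ⟨m, rfl⟩ := ZMod.intCast_surjective z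
    obtain ⟨i, t, rfl, ht⟩ := hmod m
    exact ⟨i, .v t, rfl, by simpa using ht⟩

theorem exists_linked_b (hk : 10 ≤ k) (hfin : S.Finite) (hS : S.ncard ≤ 4) {x : HkV k}
    (hx : x ∉ S) : ∃ z, HkV.b z ∉ S ∧ (Hk k).Linked S x (.b z) := by
  obtain ⟨i, y, rfl, hy⟩ := exists_proj_eq x
  have main {L} (hL : StripV.IsFan StripV.isB y L) :
      ∃ z, HkV.b z ∉ S ∧ (Hk k).Linked S (y.proj k i) (.b z) := by
    obtain ⟨w, hw, h⟩ := exists_linked_of_isFan hk hfin hS hL i hx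
    cases w with
    | b n => exact ⟨_, h⟩
    | _ => cases hw
  obtain ⟨_, hu, hu'⟩ := exists_isFan_b_u_one
  obtain ⟨_, hv, hv'⟩ := exists_isFan_b_v_one
  simp only [List.mem_cons, List.not_mem_nil, or_false] at hy
  rcases hy with rfl | rfl | rfl | rfl | rfl | rfl | rfl | rfl
  exacts [⟨_, hx, Relation.ReflTransGen.refl⟩, main isFan_b_u_zero, main hu, main hu',
    main isFan_b_v_zero, main hv, main hv', main isFan_b_a]

theorem exists_linked_u (hk : 10 ≤ k) (hfin : S.Finite) (hS : S.ncard ≤ 4) {x : HkV k}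
    (hx : x ∉ S) : ∃ z, HkV.u z ∉ S ∧ (Hk k).Linked S x (.u z) := by
  obtain ⟨i, y, rfl, hy⟩ := exists_proj_eq x
  have main {L} (hL : StripV.IsFan StripV.isU y L) :
      ∃ z, HkV.u z ∉ S ∧ (Hk k).Linked S (y.proj k i) (.u z) := by
    obtain ⟨w, hw, h⟩ := exists_linked_of_isFan hk hfin hS hL i hx
    cases w with
    | u n => exact ⟨_, h⟩
    | _ => cases hw
  obtain ⟨_, hv, hv'⟩ := exists_isFan_u_v_one
  simp only [List.mem_cons, List.not_mem_nil, or_false] at hy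
  rcases hy with rfl | rfl | rfl | rfl | rfl | rfl | rfl | rfl
  exacts [main isFan_u_b, ⟨_, hx, Relation.ReflTransGen.refl⟩,
    ⟨_, hx, Relation.ReflTransGen.refl⟩, ⟨_, hx, Relation.ReflTransGen.refl⟩,
    main isFan_u_v_zero, main hv, main hv', main isFan_u_a]

/-- `H_k - S` is connected if `S` meets the `b`-cycle or the `u`-cycle at most once. -/
theorem linked_of_cycle (hk : 10 ≤ k) (hfin : S.Finite) (hS : S.ncard ≤ 4)
    (h : (∃ p, ∀ z ≠ p, HkV.b z ∉ S) ∨ ∃ p, ∀ z ≠ p, HkV.u z ∉ S) {x y : HkV k}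
    (hx : x ∉ S) (hy : y ∉ S) : (Hk k).Linked S x y := by
  have : NeZero k := ⟨by omega⟩
  rcases h with ⟨p, hp⟩ | ⟨p, hp⟩
  · obtain ⟨z, hz, hxz⟩ := exists_linked_b hk hfin hS hx
    obtain ⟨w, hw, hyw⟩ := exists_linked_b hk hfin hS hy
    exact (hxz.trans (SimpleGraph.linked_of_cyclic (f := HkV.b)
      (fun _ => linked_of_rel rfl) hp hz hw)).trans
      hyw.symm
  · obtain ⟨z, hz, hxz⟩ := exists_linked_u hk hfin hS hx
    obtain ⟨w, hw, hyw⟩ := exists_linked_u hk hfin hS hy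
    exact (hxz.trans (SimpleGraph.linked_of_cyclic (f := HkV.u)
      (fun _ => linked_of_rel rfl) hp hz hw)).trans
      hyw.symm

end Hk

namespace HkV

variable {k : ℕ}

/-- The symmetry of `H_k` exchanging `b` with `a` and `u` with `v`. -/
def swap : HkV k → HkV k
  | b i => a i
  | u j => v j
  | v j => u j
  | a i => b i

theorem swap_swap (x : HkV k) : x.swap.swap = x := by
  cases x <;> rfl

theorem swap_injective : Function.Injective (swap : HkV k → HkV k) :=
  Function.LeftInverse.injective swap_swap

theorem hkRel_swap {x y : HkV k} (h : hkRel k x y) :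
    hkRel k x.swap y.swap ∨ hkRel k y.swap x.swap := by
  cases x <;> cases y <;> simp only [hkRel, swap] at h ⊢ <;> try tauto
  rcases h with rfl | rfl <;> simp

theorem adj_swap {x y : HkV k} (h : (Hk k).Adj x y) : (Hk k).Adj x.swap y.swap := by
  rw [Hk, SimpleGraph.fromRel_adj] at h ⊢
  refine ⟨swap_injective.ne h.1, ?_⟩
  rcases h.2 with h | h
  · exact hkRel_swap h
  · exact (hkRel_swap h).symm

instance [NeZero k] : Finite (HkV k) :=
  Finite.of_surjective
    (Sum.elim (Sum.elim HkV.b HkV.a) (Sum.elim HkV.u HkV.v) :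
      (ZMod k ⊕ ZMod k) ⊕ (ZMod (3 * k) ⊕ ZMod (3 * k)) → HkV k) <| by
    rintro (i | i | i | i)
    exacts [⟨.inl (.inl i), rfl⟩, ⟨.inr (.inl i), rfl⟩, ⟨.inr (.inr i), rfl⟩, ⟨.inl (.inr i), rfl⟩]

end HkV

/-- Removing at most four vertices from `H_k` leaves a connected graph. -/
theorem Hk.linked {k : ℕ} (hk : 10 ≤ k) {S : Set (HkV k)} (hS : S.ncard ≤ 4) {x y : HkV k}
    (hx : x ∉ S) (hy : y ∉ S) : (Hk k).Linked S x y := by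
  have : NeZero k := ⟨by omega⟩
  by_cases h : (∃ p, ∀ z ≠ p, HkV.b z ∉ S) ∨ ∃ p, ∀ z ≠ p, HkV.u z ∉ S
  · exact linked_of_cycle hk S.toFinite hS h hx hy
  by_cases h' : (∃ p, ∀ z ≠ p, HkV.a z ∉ S) ∨ ∃ p, ∀ z ≠ p, HkV.v z ∉ S
  · have hcard : (HkV.swap ⁻¹' S).ncard ≤ 4 := by
      refine (Set.ncard_le_ncard_of_injOn HkV.swap (fun _ h => h)
        HkV.swap_injective.injOn S.toFinite).trans hS
    have := linked_of_cycle (S := HkV.swap ⁻¹' S) (x := x.swap) (y := y.swap) hk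
      (Set.toFinite _) hcard h' (by simpa [HkV.swap_swap]) (by simpa [HkV.swap_swap])
    simpa only [HkV.swap_swap] using this.map HkV.swap fun _ _ => HkV.adj_swap
  push Not at h h'
  obtain ⟨b₁, -, hb₁⟩ := h.1 0
  obtain ⟨b₂, hb, hb₂⟩ := h.1 b₁
  obtain ⟨u₁, -, hu₁⟩ := h.2 0
  obtain ⟨u₂, hu, hu₂⟩ := h.2 u₁
  obtain ⟨a₁, -, ha₁⟩ := h'.1 0
  obtain ⟨q, hq, hqS⟩ := List.exists_forall_notMem_of_ncard_lt S.toFinite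
    (L := [[HkV.b b₁], [HkV.b b₂], [HkV.u u₁], [HkV.u u₂], [HkV.a a₁]])
    (by simp [hb.symm, hu.symm]) (by simpa using Nat.lt_succ_of_le hS)
  simp only [List.mem_cons, List.not_mem_nil, or_false] at hq
  rcases hq with rfl | rfl | rfl | rfl | rfl <;> simp_all

theorem Gk.nodup_b {k : ℕ} (hk : 10 ≤ k) :
    [some (HkV.b (k := k) 1), some (HkV.b 3), some (HkV.b 5), some (HkV.b 7),
      some (HkV.b 9)].Nodup := by
  have h := List.Nodup.map_on (f := fun n : ℤ => some (HkV.b (n : ZMod k))) (l := [1, 3, 5, 7, 9])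
    (by
      intro m hm n hn hmn
      have hmn' : ((0 + m : ℤ) : ZMod k) = ((0 + n : ℤ) : ZMod k) := by simpa using hmn
      refine StripV.eq_of_intCast_eq hmn' (abs_lt.2 ?_)
      simp only [List.mem_cons, List.not_mem_nil, or_false] at hm hn
      omega)
    (by decide)
  simpa using h

theorem Gk.adj_none {k : ℕ} {x : Option (HkV k)} :
    (Gk k).Adj none x ↔ x ∈ [some (HkV.b (k := k) 1), some (HkV.b 3), some (HkV.b 5),
      some (HkV.b 7), some (HkV.b 9)] := by
  rcases x with _ | (i | i | i | i) <;> simp [Gk, gkRel]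

/-- for every even integer `k ≥ 10`: (i) no set of at most 4 vertices
separates `G_k`, and (ii) the 5-element set `S = {b_1, b_3, b_5, b_7, b_9}`
(the neighborhood of the added vertex `w`) separates `G_k`.
Hence the connectivity of `G_k` is exactly 5. -/
theorem Gk_connectivity_five (k : ℕ) (hk : 10 ≤ k) (hke : Even k) :
    (∀ S : Set (Option (HkV k)), S.ncard ≤ 4 → ((Gk k).induce Sᶜ).Connected) ∧
    ∃ S : Set (Option (HkV k)),
      S = {some (HkV.b 1), some (HkV.b 3), some (HkV.b 5), some (HkV.b 7),
        some (HkV.b 9)} ∧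
      S.ncard = 5 ∧ ¬ ((Gk k).induce Sᶜ).Connected := by
  have : NeZero k := ⟨by omega⟩
  refine ⟨fun S hS => ?_, _, rfl, ?_, fun hconn => ?_⟩
  · have hcard : (some ⁻¹' S).ncard ≤ 4 :=
      (Set.ncard_le_ncard_of_injOn some (fun _ h => h) (Option.some_injective _).injOn
        S.toFinite).trans hS
    have hsome {x y : HkV k} (hx : some x ∉ S) (hy : some y ∉ S) :
        (Gk k).Linked S (some x) (some y) :=
      (Hk.linked hk hcard hx hy).map some fun x y h => by
        simpa [Gk, Hk, gkRel] using h
    obtain ⟨q, hq, hqS⟩ := List.exists_forall_notMem_of_ncard_lt S.toFinite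
      (L := [some (HkV.b (k := k) 1), some (HkV.b 3), some (HkV.b 5), some (HkV.b 7),
        some (HkV.b 9)].map fun x => [x])
      (by simpa using Gk.nodup_b hk) (by simpa using Nat.lt_succ_of_le hS)
    obtain ⟨c, hc, rfl⟩ := List.mem_map.1 hq
    have hcS : c ∉ S := hqS c (by simp)
    obtain ⟨z, rfl⟩ : ∃ z, c = some z := by
      rcases c with _ | z
      · simp at hc
      · exact ⟨z, rfl⟩
    rw [SimpleGraph.connected_iff_exists_forall_reachable]
    refine ⟨⟨some z, hcS⟩, ?_⟩
    rintro ⟨_ | x, hx⟩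
    · exact ((Gk.adj_none.2 hc).linked hx hcS).symm.reachable hcS hx
    · exact (hsome hcS hx).reachable hcS hx
  · have h := List.toFinset_card_of_nodup (Gk.nodup_b hk)
    rw [← Set.ncard_coe_finset] at h
    simpa using h
  · obtain ⟨p⟩ := hconn.preconnected ⟨none, by simp⟩ ⟨some (HkV.u 0), by simp⟩
    cases p with
    | @cons _ y _ h _ =>
      have hy := Gk.adj_none.1 (SimpleGraph.comap_adj.1 h)
      exact y.2 (by simpa using hy)
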